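/- Let m ≥ 2, n ≥ 2, α < 0, and let Π^α be the contract function Π^α_i(P; j) = s_qu(p_i; j) − (m−1)² s_qu(p̄_{−i}; j) + α p̄_{−i,j}. Let C ⊆ [m] be a coalition with |C| ≥ 2, and let P, Q ∈ (Δ_n)^m satisfy p_i = q_i for all i ∉ C. Let j̃ ∈ [n] be an index maximizing q_{C,ℓ} − p_{C,ℓ} over ℓ ∈ [n]. Then Σ_{i∈C} Π^α_i(Q; j̃) ≤ Σ_{i∈C} Π^α_i(P; j̃), with equality only if q_{C,ℓ} = p_{C,ℓ} for all ℓ ∈ [n]. -/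

import Mathlib

open Finset

/-- Brier's quadratic scoring rule: `s_qu(p; j) = 1 - (1 - p j)^2 - ∑_{l ≠ j} (p l)^2`. -/
noncomputable def squ {n : ℕ} (p : Fin n → ℝ) (j : Fin n) : ℝ :=
  1 - (1 - p j) ^ 2 - ∑ l ∈ ({j}ᶜ : Finset (Fin n)), (p l) ^ 2

/-- The average report `p̄_{-i}` of all experts except `i`. -/
noncomputable def avgExcept {m n : ℕ} (P : Fin m → Fin n → ℝ) (i : Fin m) : Fin n → ℝ :=
  fun j => (1 / ((m : ℝ) - 1)) * ∑ k ∈ ({i}ᶜ : Finset (Fin m)), P k j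

/-- The contract function `Π^α_i(P; j) = s_qu(p_i; j) - (m-1)^2 s_qu(p̄_{-i}; j) + α p̄_{-i,j}`. -/
noncomputable def piAlpha {m n : ℕ} (α : ℝ) (P : Fin m → Fin n → ℝ) (i : Fin m) (j : Fin n) : ℝ :=
  squ (P i) j - ((m : ℝ) - 1) ^ 2 * squ (avgExcept P i) j + α * avgExcept P i j

/-- A tuple of reports, one probability distribution in the simplex `Δ_n` per expert. -/
def IsSimplexTuple {m n : ℕ} (P : Fin m → Fin n → ℝ) : Prop :=
  ∀ k, P k ∈ stdSimplex ℝ (Fin n)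

lemma squ_eq {n : ℕ} (p : Fin n → ℝ) (j : Fin n) :
    squ p j = 2 * p j - ∑ l, p l ^ 2 := by
  have h := Finset.sum_add_sum_compl ({j} : Finset (Fin n)) fun l => p l ^ 2
  rw [sum_singleton] at h
  unfold squ
  linarith

lemma avgExcept_eq {m n : ℕ} (P : Fin m → Fin n → ℝ) (i : Fin m) (j : Fin n) :
    avgExcept P i j = (∑ k, P k j - P i j) / ((m : ℝ) - 1) := by
  have h := Finset.sum_add_sum_compl ({i} : Finset (Fin m)) fun k => P k j
  rw [sum_singleton] at h
  rw [avgExcept, ← h]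
  ring

/-- The squared norm of an expert's own report cancels from her reward. -/
lemma piAlpha_eq {m n : ℕ} (hm : 2 ≤ m) (α : ℝ) (P : Fin m → Fin n → ℝ) (i : Fin m)
    (j : Fin n) :
    piAlpha α P i j = 2 * P i j + ∑ l, (∑ k, P k l) ^ 2 - 2 * ∑ l, (∑ k, P k l) * P i l
      + (α / ((m : ℝ) - 1) - 2 * ((m : ℝ) - 1)) * (∑ k, P k j - P i j) := by
  have hm' : (m : ℝ) - 1 ≠ 0 := by
    have : (2 : ℝ) ≤ m := by exact_mod_cast hm
    linarith
  have hsq : ((m : ℝ) - 1) ^ 2 * ∑ l, avgExcept P i l ^ 2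
      = ∑ l, (∑ k, P k l) ^ 2 - 2 * ∑ l, (∑ k, P k l) * P i l + ∑ l, P i l ^ 2 := by
    rw [mul_sum, mul_sum, ← sum_sub_distrib, ← sum_add_distrib]
    refine sum_congr rfl fun l _ => ?_
    rw [avgExcept_eq]
    field_simp
    ring
  rw [piAlpha, squ_eq, squ_eq, mul_sub, hsq, avgExcept_eq]
  field_simp
  ring

lemma sum_piAlpha_eq {m n : ℕ} (hm : 2 ≤ m) (α : ℝ) (P : Fin m → Fin n → ℝ)
    (C : Finset (Fin m)) (j : Fin n) :
    ∑ i ∈ C, piAlpha α P i j = 2 * ∑ i ∈ C, P i j + C.card * ∑ l, (∑ k, P k l) ^ 2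
      - 2 * ∑ l, (∑ k, P k l) * ∑ i ∈ C, P i l
      + (α / ((m : ℝ) - 1) - 2 * ((m : ℝ) - 1))
        * (C.card * ∑ k, P k j - ∑ i ∈ C, P i j) := by
  simp only [piAlpha_eq hm, sum_add_distrib, sum_sub_distrib, ← mul_sum, sum_const,
    nsmul_eq_mul]
  rw [sum_comm]
  simp only [← mul_sum]

lemma sum_sum_eq_card {m n : ℕ} {P : Fin m → Fin n → ℝ} (hP : IsSimplexTuple P)
    (C : Finset (Fin m)) : ∑ l, ∑ i ∈ C, P i l = C.card := by
  rw [sum_comm, sum_congr rfl fun i _ => (hP i).2]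
  simp

/-- A nonnegative weighted sum is at most the total weight times the maximal value. -/
lemma sum_mul_le_of_forall_le {ι : Type*} [Fintype ι] {w d : ι → ℝ} {c : ℝ}
    (hw : ∀ l, 0 ≤ w l) (hd : ∀ l, d l ≤ c) : ∑ l, w l * d l ≤ (∑ l, w l) * c := by
  rw [sum_mul]
  exact sum_le_sum fun l _ => mul_le_mul_of_nonneg_left (hd l) (hw l)

lemma sum_piAlpha_sub_le {m n : ℕ} (hm : 2 ≤ m) (α : ℝ) (C : Finset (Fin m))
    (hC : 2 ≤ C.card) {P Q : Fin m → Fin n → ℝ} (hP : IsSimplexTuple P)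
    (hQ : IsSimplexTuple Q) (hout : ∀ i ∉ C, P i = Q i) (j : Fin n)
    (hj : ∀ l, (∑ i ∈ C, Q i l) - (∑ i ∈ C, P i l)
      ≤ (∑ i ∈ C, Q i j) - (∑ i ∈ C, P i j)) :
    ∑ i ∈ C, piAlpha α Q i j - ∑ i ∈ C, piAlpha α P i j
      ≤ α * (((C.card : ℝ) - 1) / ((m : ℝ) - 1))
        * ((∑ i ∈ C, Q i j) - (∑ i ∈ C, P i j)) := by
  have hk : (2 : ℝ) ≤ C.card := by exact_mod_cast hC
  have hSP (l) : ∑ k, P k l = ∑ i ∈ C, P i l + ∑ i ∈ Cᶜ, P i l :=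
    (Finset.sum_add_sum_compl C fun k => P k l).symm
  have hSQ (l) : ∑ k, Q k l = ∑ i ∈ C, Q i l + ∑ i ∈ Cᶜ, P i l := by
    rw [← Finset.sum_add_sum_compl C fun k => Q k l]
    congr 1
    exact sum_congr rfl fun i hi => by rw [hout i (mem_compl.mp hi)]
  have hcX := sum_sum_eq_card hP C
  have hcY := sum_sum_eq_card hQ C
  have hcR : ∑ l, ∑ i ∈ Cᶜ, P i l = (m : ℝ) - C.card := by
    rw [sum_sum_eq_card hP, card_compl, Fintype.card_fin,
      Nat.cast_sub (by simpa using card_le_univ C)]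
  have hX (l) : 0 ≤ ∑ i ∈ C, P i l := sum_nonneg fun i _ => (hP i).1 l
  have hY (l) : 0 ≤ ∑ i ∈ C, Q i l := sum_nonneg fun i _ => (hQ i).1 l
  have hR (l) : 0 ≤ ∑ i ∈ Cᶜ, P i l := sum_nonneg fun i _ => (hP i).1 l
  rw [sum_piAlpha_eq hm, sum_piAlpha_eq hm]
  simp only [hSP, hSQ]
  set X : Fin n → ℝ := fun l => ∑ i ∈ C, P i l
  set Y : Fin n → ℝ := fun l => ∑ i ∈ C, Q i l
  set R : Fin n → ℝ := fun l => ∑ i ∈ Cᶜ, P i l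
  change ∀ l, Y l - X l ≤ Y j - X j at hj
  have h₁ := sum_mul_le_of_forall_le (w := fun l => Y l + X l) (d := fun l => Y l - X l)
    (fun l => add_nonneg (hY l) (hX l)) hj
  have h₂ := sum_mul_le_of_forall_le (w := R) (d := fun l => Y l - X l) hR hj
  rw [sum_add_distrib, hcX, hcY] at h₁
  rw [hcR] at h₂
  have hquad : (C.card * ∑ l, (Y l + R l) ^ 2 - 2 * ∑ l, (Y l + R l) * Y l)
      - (C.card * ∑ l, (X l + R l) ^ 2 - 2 * ∑ l, (X l + R l) * X l)
      = ((C.card : ℝ) - 2) * ∑ l, (Y l + X l) * (Y l - X l)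
        + 2 * ((C.card : ℝ) - 1) * ∑ l, R l * (Y l - X l) := by
    simp only [mul_sum, ← sum_sub_distrib, ← sum_add_distrib]
    exact sum_congr rfl fun l _ => by ring
  have h₁' := mul_le_mul_of_nonneg_left h₁ (sub_nonneg.mpr hk)
  have h₂' := mul_le_mul_of_nonneg_left h₂ (by linarith : 0 ≤ 2 * ((C.card : ℝ) - 1))
  change 2 * Y j + C.card * ∑ l, (Y l + R l) ^ 2 - 2 * ∑ l, (Y l + R l) * Y l
      + (α / ((m : ℝ) - 1) - 2 * ((m : ℝ) - 1)) * (C.card * (Y j + R j) - Y j)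
    - (2 * X j + C.card * ∑ l, (X l + R l) ^ 2 - 2 * ∑ l, (X l + R l) * X l
      + (α / ((m : ℝ) - 1) - 2 * ((m : ℝ) - 1)) * (C.card * (X j + R j) - X j))
    ≤ α * (((C.card : ℝ) - 1) / ((m : ℝ) - 1)) * (Y j - X j)
  linear_combination h₁' + h₂' + hquad

/-- **Case 1 (`α < 0`).** If a coalition `C` deviates from `P` to `Q` (agreeing outside
`C`), then at an outcome `j̃` maximizing `q_{C,l} - p_{C,l}`, the coalition's total reward
does not increase, with equality only if `q_{C,l} = p_{C,l}` for all `l`. -/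
theorem coalition_deviation_neg_alpha (m n : ℕ) (hm : 2 ≤ m) (hn : 2 ≤ n) (α : ℝ)
    (hα : α < 0) (C : Finset (Fin m)) (hC : 2 ≤ C.card)
    (P Q : Fin m → Fin n → ℝ) (hP : IsSimplexTuple P) (hQ : IsSimplexTuple Q)
    (hout : ∀ i ∉ C, P i = Q i) (jt : Fin n)
    (hjt : ∀ l, (∑ i ∈ C, Q i l) - (∑ i ∈ C, P i l)
      ≤ (∑ i ∈ C, Q i jt) - (∑ i ∈ C, P i jt)) :
    (∑ i ∈ C, piAlpha α Q i jt ≤ ∑ i ∈ C, piAlpha α P i jt) ∧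
    (∑ i ∈ C, piAlpha α Q i jt = ∑ i ∈ C, piAlpha α P i jt →
      ∀ l, ∑ i ∈ C, Q i l = ∑ i ∈ C, P i l) := by
  have hsum : ∑ l, ((∑ i ∈ C, Q i l) - ∑ i ∈ C, P i l) = 0 := by
    rw [sum_sub_distrib, sum_sum_eq_card hP, sum_sum_eq_card hQ, sub_self]
  have hd : 0 ≤ (∑ i ∈ C, Q i jt) - ∑ i ∈ C, P i jt := by
    by_contra! hneg
    have : Nonempty (Fin n) := ⟨jt⟩
    have := sum_lt_sum_of_nonempty univ_nonempty
      fun l (_ : l ∈ univ) => (hjt l).trans_lt hneg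
    rw [hsum, sum_const_zero] at this
    exact this.false
  have hcoef : α * (((C.card : ℝ) - 1) / ((m : ℝ) - 1)) < 0 := by
    have hm' : (2 : ℝ) ≤ m := by exact_mod_cast hm
    have hC' : (2 : ℝ) ≤ C.card := by exact_mod_cast hC
    exact mul_neg_of_neg_of_pos hα (div_pos (by linarith) (by linarith))
  have hmain := sum_piAlpha_sub_le hm α C hC hP hQ hout jt hjt
  refine ⟨sub_nonpos.mp (hmain.trans (mul_nonpos_of_nonpos_of_nonneg hcoef.le hd)),
    fun heq l => ?_⟩
  rw [heq, sub_self] at hmain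
  have hd₀ : (∑ i ∈ C, Q i jt) - ∑ i ∈ C, P i jt ≤ 0 :=
    nonpos_of_mul_nonneg_right hmain hcoef
  have hle (l) : (∑ i ∈ C, Q i l) - ∑ i ∈ C, P i l ≤ 0 := (hjt l).trans hd₀
  exact sub_eq_zero.mp
    ((sum_eq_zero_iff_of_nonpos fun l _ => hle l).mp hsum l (mem_univ l))
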